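/- arXiv:1708.06620 — 2 statements merged into one kernel-verified Lean document; each statement's English description precedes it below -/
import Mathlib

section
/- Let L be a normal subgroup of a group G, 𝔸 an associative ring, V an 𝔸-module, θ : L → Aut_𝔸(V) an 𝔸L-module structure whose automorphism group H = Aut_{𝔸L}(V) is abelian. Let Θ, Θ′ : G → Aut_𝔸(V) be group homomorphisms with Θ|_L = Θ′|_L = θ, and let ρ be the G-action on H given by ρ(x)(h) = Θ(x)hΘ(x)^{-1}. If H^1(G,L;(H,ρ)) = 0, then there exists h ∈ H with Θ′(x) = hΘ(x)h^{-1} for all x ∈ G; i.e. the two 𝔸G-module structures are isomorphic via an 𝔸L-automorphism of V. -/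
/-!
Statement 15: let `L ◁ G`, `𝔸` a ring, `V` an `𝔸`-module, `θ : L → Aut_𝔸(V)` an
`𝔸L`-structure whose automorphism group `H = Aut_{𝔸L}(V)` is abelian.  Let
`Θ, Θ' : G → Aut_𝔸(V)` be homomorphisms restricting to `θ` on `L` and `ρ` the `G`-action
`ρ(x)(h) = Θ(x) h Θ(x)⁻¹` on `H`.  If `H^1(G,L;(H,ρ)) = 0` (every relative `1`-cocycle
is a coboundary `dα_a(x) = a⁻¹ ρ(x)(a)`, `a ∈ H^L`), then `Θ' = h Θ h⁻¹` for some
`h ∈ H`; i.e. the two `𝔸G`-structures are isomorphic via an `𝔸L`-automorphism of `V`.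
-/

/-- Two homomorphisms that agree on a normal subgroup differ pointwise by elements centralizing
its image. -/
theorem MonoidHom.mul_inv_mem_centralizer_of_eqOn {G M : Type*} [Group G] [Group M]
    {L : Subgroup G} (hN : L.Normal) {f g : G →* M} (hfg : ∀ l ∈ L, f l = g l) (x : G) :
    g x * (f x)⁻¹ ∈ Subgroup.centralizer (f '' L) := by
  rw [Subgroup.mem_centralizer_iff]
  rintro _ ⟨l, hl, rfl⟩
  have hm : x⁻¹ * l * x ∈ L := by simpa using hN.conj_mem l hl x⁻¹
  have h : (g x)⁻¹ * f l * g x = (f x)⁻¹ * f l * f x := by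
    simpa [hfg l hl] using (hfg _ hm).symm
  calc f l * (g x * (f x)⁻¹) = g x * ((g x)⁻¹ * f l * g x) * (f x)⁻¹ := by group
    _ = g x * (f x)⁻¹ * f l := by rw [h]; group

theorem stmt15 (G : Type) [Group G] (L : Subgroup G) (hN : L.Normal)
    (𝔸 : Type) [Ring 𝔸] (V : Type) [AddCommGroup V] [Module 𝔸 V]
    (θ : L →* (V ≃ₗ[𝔸] V))
    (H : Subgroup (V ≃ₗ[𝔸] V))
    (hH : H = Subgroup.centralizer (Set.range fun l : L => θ l))
    (hab : ∀ a ∈ H, ∀ b ∈ H, a * b = b * a)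
    (Θ Θ' : G →* (V ≃ₗ[𝔸] V))
    (hΘ : ∀ l : L, Θ l = θ l) (hΘ' : ∀ l : L, Θ' l = θ l)
    -- `H^1(G,L;(H,ρ)) = 0` for the action `ρ(x)(h) = Θ(x) h Θ(x)⁻¹`
    (hH1 : ∀ α : G → (V ≃ₗ[𝔸] V), (∀ x : G, α x ∈ H) → (∀ l : L, α (l : G) = 1) →
      (∀ x y : G, α (x * y) = α x * (Θ x * α y * (Θ x)⁻¹)) →
      ∃ a ∈ H, (∀ l : L, θ l * a = a * θ l) ∧
        ∀ x : G, α x = a⁻¹ * (Θ x * a * (Θ x)⁻¹)) :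
    ∃ h ∈ H, ∀ x : G, Θ' x = h * Θ x * h⁻¹ := by
  have himage : Θ '' L = Set.range fun l : L => θ l := by
    ext k
    simp [← hΘ]
  obtain ⟨a, ha, -, hcob⟩ := hH1 (fun x => Θ' x * (Θ x)⁻¹)
    (fun x => by
      rw [hH, ← himage]
      exact MonoidHom.mul_inv_mem_centralizer_of_eqOn hN
        (fun l hl => (hΘ ⟨l, hl⟩).trans (hΘ' ⟨l, hl⟩).symm) x)
    (fun l => by rw [hΘ, hΘ', mul_inv_cancel])
    (fun x y => by rw [map_mul, map_mul]; group)
  refine ⟨a⁻¹, H.inv_mem ha, fun x => ?_⟩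
  rw [eq_mul_of_mul_inv_eq (hcob x)]
  group
end

section
/- Let 𝕂 be an algebraically closed field and R a finitely generated commutative Hopf algebra over 𝕂 (the coordinate ring of an affine group scheme of finite type over 𝕂) whose nilradical is a prime ideal (i.e. the group scheme is irreducible). Then R is primary: every zero-divisor of R lies in the nilradical, i.e. is nilpotent. -/
/-!
Statement 19: let `𝕂` be an algebraically closed field and `R` a finitely generated
commutative Hopf algebra over `𝕂` (the coordinate ring of an affine group scheme of
finite type over `𝕂`) whose nilradical is a prime ideal (i.e. the group scheme is
irreducible).  Then `R` is primary: every zero-divisor of `R` is nilpotent.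
-/

open scoped TensorProduct

/-- Points over an algebraically closed field separate a nonzero element of a finitely generated
domain from zero. -/
theorem exists_algHom_apply_ne_zero {k P : Type*} [Field k] [IsAlgClosed k] [CommRing P]
    [IsDomain P] [Algebra k P] [Algebra.FiniteType k P] {p : P} (hp : p ≠ 0) :
    ∃ χ : P →ₐ[k] k, χ p ≠ 0 := by
  have : IsJacobsonRing P := isJacobsonRing_of_finiteType (A := k)
  have hJ : (⊥ : Ideal P).jacobson = ⊥ :=
    IsJacobsonRing.out ‹_› Ideal.isPrime_bot.isRadical
  obtain ⟨M, hM, hpM⟩ : ∃ M : Ideal P, M.IsMaximal ∧ p ∉ M := by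
    by_contra! h
    have : p ∈ (⊥ : Ideal P).jacobson := Ideal.mem_sInf.mpr fun {I} hI ↦ h I hI.2
    exact hp (by simpa only [hJ, Ideal.mem_bot] using this)
  let _ : Field (P ⧸ M) := Ideal.Quotient.field M
  have : Module.Finite k (P ⧸ M) := finite_of_finite_type_of_isJacobsonRing k (P ⧸ M)
  let e : k ≃ₐ[k] P ⧸ M :=
    .ofBijective (Algebra.ofId k _) IsAlgClosed.algebraMap_bijective_of_isIntegral
  refine ⟨e.symm.toAlgHom.comp (Ideal.Quotient.mkₐ k M), ?_⟩
  simpa [Ideal.Quotient.eq_zero_iff_mem] using hpM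

theorem isDomain_tensorProduct_of_finiteType {k P Q : Type*} [Field k] [IsAlgClosed k]
    [CommRing P] [IsDomain P] [Algebra k P] [Algebra.FiniteType k P]
    [CommRing Q] [IsDomain Q] [Algebra k Q] : IsDomain (P ⊗[k] Q) := by
  have : Nontrivial (P ⊗[k] Q) := inferInstance
  refine @NoZeroDivisors.to_isDomain _ _ this ⟨fun {x y} hxy ↦ ?_⟩
  by_contra! h
  let b := Module.Basis.ofVectorSpace k Q
  let B := Algebra.TensorProduct.basis P b
  obtain ⟨i, hi⟩ : ∃ i, B.repr x i ≠ 0 := by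
    by_contra! H; exact h.1 (B.repr.map_eq_zero_iff.mp (Finsupp.ext H))
  obtain ⟨j, hj⟩ : ∃ j, B.repr y j ≠ 0 := by
    by_contra! H; exact h.2 (B.repr.map_eq_zero_iff.mp (Finsupp.ext H))
  obtain ⟨χ, hχ⟩ := exists_algHom_apply_ne_zero (k := k) (mul_ne_zero hi hj)
  let Θ : P ⊗[k] Q →ₐ[k] Q :=
    Algebra.TensorProduct.lift ((Algebra.ofId k Q).comp χ) (.id k Q) fun _ _ ↦ .all _ _
  have hΘ (z : P ⊗[k] Q) (l) : b.repr (Θ z) l = χ (B.repr z l) := by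
    induction z with
    | zero => simp
    | add z w hz hw => simp [hz, hw]
    | tmul p q =>
      simp [Θ, B, Algebra.ofId_apply, ← Algebra.smul_def]
  have : Θ x * Θ y = 0 := by rw [← map_mul, hxy, map_zero]
  rw [map_mul, ← hΘ, ← hΘ] at hχ
  rcases mul_eq_zero.mp this with h0 | h0 <;> simp [h0] at hχ

/-- Over an algebraically closed field, a tensor product of domains is a domain. -/
theorem isDomain_tensorProduct {k P Q : Type*} [Field k] [IsAlgClosed k]
    [CommRing P] [IsDomain P] [Algebra k P]
    [CommRing Q] [IsDomain Q] [Algebra k Q] : IsDomain (P ⊗[k] Q) := by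
  have : Nontrivial (P ⊗[k] Q) := inferInstance
  refine @NoZeroDivisors.to_isDomain _ _ this ⟨fun {x y} hxy ↦ ?_⟩
  obtain ⟨C, hC, hx⟩ := exists_fg_and_mem_baseChange x
  obtain ⟨D, hD, hy⟩ := exists_fg_and_mem_baseChange y
  let E := C ⊔ D
  have : Algebra.FiniteType k E := E.fg_iff_finiteType.mp (hC.sup hD)
  have : IsDomain (P ⊗[k] E) :=
    have := isDomain_tensorProduct_of_finiteType (k := k) (P := E) (Q := P)
    (Algebra.TensorProduct.comm k P E).toMulEquiv.isDomain
  let f : P ⊗[k] E →ₐ[k] P ⊗[k] Q := Algebra.TensorProduct.map (AlgHom.id k P) E.val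
  have hf : Function.Injective f :=
    Module.Flat.lTensor_preserves_injective_linearMap _ Subtype.val_injective
  have lift {S : Subalgebra k Q} (hS : S ≤ E) {z : P ⊗[k] Q} (hz : z ∈ S.baseChange P) :
      ∃ w, f w = z := by
    obtain ⟨w, rfl⟩ := hz
    refine ⟨Algebra.TensorProduct.map (AlgHom.id k P) (Subalgebra.inclusion hS) w, ?_⟩
    induction w with
    | zero => simp
    | add z w hz hw => simp only [map_add, hz, hw]
    | tmul p q => rfl
  obtain ⟨x, rfl⟩ := lift le_sup_left hx
  obtain ⟨y, rfl⟩ := lift le_sup_right hy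
  rw [← map_mul, map_eq_zero_iff f hf] at hxy
  rcases mul_eq_zero.mp hxy with h | h <;> simp [h]

/-- A module over a domain which is not torsion at `v` has a linear functional with values in the
fraction field that does not vanish at `v`. -/
theorem exists_linearMap_fractionRing_apply_ne_zero {D V : Type*} [CommRing D] [IsDomain D]
    [AddCommGroup V] [Module D V] {v : V} (hv : ∀ d : D, d • v = 0 → d = 0) :
    ∃ φ : V →ₗ[D] FractionRing D, φ v ≠ 0 := by
  let S := nonZeroDivisors D
  have hw : LocalizedModule.mkLinearMap S V v ≠ 0 := by
    intro h
    obtain ⟨s, hs⟩ := (IsLocalizedModule.eq_zero_iff S _).mp h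
    exact nonZeroDivisors.coe_ne_zero s (hv _ hs)
  obtain ⟨f, hf⟩ : ∃ f : Module.Dual (FractionRing D) (LocalizedModule S V),
      f (LocalizedModule.mkLinearMap S V v) ≠ 0 := by
    by_contra! h
    exact hw ((Module.forall_dual_apply_eq_zero_iff (FractionRing D) _).mp h)
  exact ⟨f.restrictScalars D ∘ₗ LocalizedModule.mkLinearMap S V, hf⟩

theorem exists_linearMap_fractionRing_quotient_apply_ne_zero {A V : Type*} [CommRing A]
    (p : Ideal A) [p.IsPrime] [AddCommGroup V] [Module A V]
    (hp : ∀ a ∈ p, ∀ v : V, a • v = 0) {v : V} (hv : ∀ a : A, a • v = 0 → a ∈ p) :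
    ∃ φ : V →ₗ[A] FractionRing (A ⧸ p), φ v ≠ 0 := by
  have htors : Module.IsTorsionBySet A V p := fun v a ↦ hp a a.2 v
  let _ := htors.module
  have : IsScalarTower A (A ⧸ p) V := htors.isScalarTower
  obtain ⟨φ, hφ⟩ := exists_linearMap_fractionRing_apply_ne_zero (D := A ⧸ p) (v := v) fun d hd ↦ by
    obtain ⟨a, rfl⟩ := Ideal.Quotient.mk_surjective d
    exact Ideal.Quotient.eq_zero_iff_mem.mpr (hv a hd)
  exact ⟨φ.restrictScalars A, hφ⟩

theorem isNilpotent_of_map_left_eq_zero {k A C B : Type*} [CommRing k] [CommRing A] [CommRing C]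
    [CommRing B] [Algebra k A] [Algebra k C] [Algebra k B] {f : A →ₐ[k] C}
    (hf : Function.Surjective f) (hker : RingHom.ker f ≤ nilradical A) {z : A ⊗[k] B}
    (hz : Algebra.TensorProduct.map f (AlgHom.id k B) z = 0) : IsNilpotent z := by
  have hz' : z ∈ RingHom.ker (Algebra.TensorProduct.map f (AlgHom.id k B)) := hz
  rw [Algebra.TensorProduct.rTensor_ker f hf] at hz'
  refine mem_nilradical.mp ((Ideal.map_le_iff_le_comap.mpr fun n hn ↦ ?_) hz')
  exact mem_nilradical.mpr ((mem_nilradical.mp (hker hn)).map _)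

theorem isNilpotent_of_map_right_eq_zero {k A C B : Type*} [CommRing k] [CommRing A] [CommRing C]
    [CommRing B] [Algebra k A] [Algebra k C] [Algebra k B] {f : A →ₐ[k] C}
    (hf : Function.Surjective f) (hker : RingHom.ker f ≤ nilradical A) {z : B ⊗[k] A}
    (hz : Algebra.TensorProduct.map (AlgHom.id k B) f z = 0) : IsNilpotent z := by
  have hz' : z ∈ RingHom.ker (Algebra.TensorProduct.map (AlgHom.id k B) f) := hz
  rw [Algebra.TensorProduct.lTensor_ker f hf] at hz'
  refine mem_nilradical.mp ((Ideal.map_le_iff_le_comap.mpr fun n hn ↦ ?_) hz')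
  exact mem_nilradical.mpr ((mem_nilradical.mp (hker hn)).map _)

/-- An `A`-linear map from an ideal of `A` to an `A`-algebra `F` remains compatible with
multiplication after tensoring with `B`. -/
theorem map_tensor_eq_zero_of_mul_eq_zero {k A B F : Type*} [Field k] [CommRing A] [CommRing B]
    [CommRing F] [Algebra k A] [Algebra k B] [Algebra k F] [Algebra A F] [IsScalarTower k A F]
    {V : Ideal A} (φ : V →ₗ[A] F) {c : A ⊗[k] B} {y : V ⊗[k] B}
    (h : c * (V.subtype.restrictScalars k).rTensor B y = 0) :
    Algebra.TensorProduct.map (IsScalarTower.toAlgHom k A F) (AlgHom.id k B) c *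
      (φ.restrictScalars k).rTensor B y = 0 := by
  obtain ⟨w, hw, hw'⟩ : ∃ w : V ⊗[k] B,
      (V.subtype.restrictScalars k).rTensor B w =
        c * (V.subtype.restrictScalars k).rTensor B y ∧
      (φ.restrictScalars k).rTensor B w =
        Algebra.TensorProduct.map (IsScalarTower.toAlgHom k A F) (AlgHom.id k B) c *
          (φ.restrictScalars k).rTensor B y := by
    clear h
    induction c with
    | zero => exact ⟨0, by simp, by simp⟩
    | add c d hc hd =>
      obtain ⟨u, hu, hu'⟩ := hc
      obtain ⟨v, hv, hv'⟩ := hd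
      exact ⟨u + v, by rw [map_add, hu, hv, add_mul], by rw [map_add, hu', hv', map_add, add_mul]⟩
    | tmul a b =>
      induction y with
      | zero => exact ⟨0, by simp, by simp⟩
      | add c d hc hd =>
        obtain ⟨u, hu, hu'⟩ := hc
        obtain ⟨v, hv, hv'⟩ := hd
        exact ⟨u + v, by rw [map_add, hu, hv, map_add, mul_add],
          by rw [map_add, hu', hv', map_add, mul_add]⟩
      | tmul v b' =>
        exact ⟨(a • v) ⊗ₜ (b * b'), by simp, by simp [Algebra.smul_def]⟩
  have hinj : Function.Injective ((V.subtype.restrictScalars k).rTensor B) :=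
    Module.Flat.rTensor_preserves_injective_linearMap _ Subtype.val_injective
  rw [← hw', hinj (hw.trans h |>.trans (map_zero _).symm), map_zero]

/-- If `A` is irreducible and noetherian and `B` is a domain over an algebraically closed field,
every element of `A ⊗ B` killed by a non-nilpotent one is killed by a non-nilpotent element
of `A`. -/
theorem exists_not_isNilpotent_smul_eq_zero {k A B : Type*} [Field k] [IsAlgClosed k]
    [CommRing A] [IsNoetherianRing A] [CommRing B] [IsDomain B] [Algebra k A] [Algebra k B]
    (hA : (nilradical A).IsPrime) {c x : A ⊗[k] B} (hc : ¬ IsNilpotent c) (h : c * x = 0) :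
    ∃ t : A, ¬ IsNilpotent t ∧ t • x = 0 := by
  classical
  by_contra! H
  set N := nilradical A
  let F := FractionRing (A ⧸ N)
  obtain ⟨y, hcy, hy⟩ : ∃ y : A ⊗[k] B, c * y = 0 ∧ ∀ a : A, a • y = 0 ↔ a ∈ N := by
    let M := Submodule.span A {x}
    have hmin : N ∈ (Module.annihilator A M).minimalPrimes := by
      refine ⟨⟨hA, fun a ha ↦ ?_⟩, fun q hq _ ↦ ?_⟩
      · by_contra hn
        refine H a hn ?_
        exact congrArg Subtype.val
          (Module.mem_annihilator.mp ha ⟨x, Submodule.mem_span_singleton_self x⟩)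
      · have := hq.1
        exact nilradical_le_prime q
    obtain ⟨-, ⟨y, hyM⟩, hy⟩ := isAssociatedPrime_iff.mp
      (Module.associatedPrimes.minimalPrimes_annihilator_subset_associatedPrimes A M hmin)
    obtain ⟨a, rfl⟩ := Submodule.mem_span_singleton.mp hyM
    refine ⟨a • x, by rw [mul_smul_comm, h, smul_zero], fun b ↦ ?_⟩
    rw [hy, Submodule.mem_colon_singleton, Submodule.mem_bot, Subtype.ext_iff]
    rfl
  let b := Module.Basis.ofVectorSpace k B
  let E := Algebra.TensorProduct.basis A b
  obtain ⟨i, hi⟩ : ∃ i, ∀ a : A, a • E.repr y i = 0 → a ∈ N := by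
    by_contra! H'
    choose d hd hdN using H'
    refine (hA.prod_mem_iff (s := (E.repr y).support) (x := d)).not.mpr
      (by push Not; exact fun i _ ↦ hdN i) ((hy _).mp (E.repr.map_eq_zero_iff.mp ?_))
    ext j
    by_cases hj : j ∈ (E.repr y).support
    · rw [map_smul, Finsupp.smul_apply, ← Finset.prod_erase_mul _ _ hj, mul_smul, hd, smul_zero]
      rfl
    · rw [map_smul, Finsupp.smul_apply, Finsupp.notMem_support_iff.mp hj, smul_zero]
      rfl
  let V : Ideal A := Submodule.annihilator N
  have hyV (j) : E.repr y j ∈ V := Submodule.mem_annihilator.mpr fun n hn ↦ by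
    rw [smul_eq_mul, mul_comm, ← smul_eq_mul, ← Finsupp.smul_apply, ← map_smul,
      (hy n).mpr hn, map_zero, Finsupp.zero_apply]
  obtain ⟨φ, hφ⟩ := exists_linearMap_fractionRing_quotient_apply_ne_zero N (V := V)
    (fun n hn v ↦ Subtype.ext <| by
      simpa [mul_comm] using Submodule.mem_annihilator.mp v.2 n hn)
    (v := ⟨E.repr y i, hyV i⟩) fun a ha ↦ hi a (congrArg Subtype.val ha)
  let z : V ⊗[k] B := ∑ j ∈ (E.repr y).support, (⟨E.repr y j, hyV j⟩ : V) ⊗ₜ b j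
  have hzy : (V.subtype.restrictScalars k).rTensor B z = y := by
    conv_rhs => rw [← E.linearCombination_repr y, Finsupp.linearCombination_apply, Finsupp.sum]
    simp [z, E, TensorProduct.smul_tmul']
  have hmul := map_tensor_eq_zero_of_mul_eq_zero φ (c := c) (y := z) (by rw [hzy, hcy])
  have : IsDomain (F ⊗[k] B) := isDomain_tensorProduct
  rcases mul_eq_zero.mp hmul with h0 | h0
  · refine hc (isNilpotent_of_map_left_eq_zero (f := Ideal.Quotient.mkₐ k N)
      (Ideal.Quotient.mkₐ_surjective k N) (Ideal.Quotient.mkₐ_ker k N).le ?_)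
    have hinj : Function.Injective (Algebra.TensorProduct.map
        (IsScalarTower.toAlgHom k (A ⧸ N) F) (AlgHom.id k B)) :=
      Module.Flat.rTensor_preserves_injective_linearMap
        (IsScalarTower.toAlgHom k (A ⧸ N) F).toLinearMap (IsFractionRing.injective (A ⧸ N) F)
    refine hinj (Eq.trans ?_ (h0.trans (map_zero _).symm))
    rw [← AlgHom.comp_apply, ← Algebra.TensorProduct.map_comp]
    rfl
  · have hcoord : (Algebra.TensorProduct.basis F b).repr
        ((φ.restrictScalars k).rTensor B z) i = φ ⟨E.repr y i, hyV i⟩ := by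
      simp only [z, map_sum, LinearMap.rTensor_tmul, LinearMap.coe_restrictScalars,
        Finsupp.coe_finsetSum, Finset.sum_apply, Algebra.TensorProduct.basis_repr_tmul]
      simp only [Module.Basis.repr_self, Finsupp.mapRange_single, map_one, Finsupp.smul_single,
        smul_eq_mul, mul_one, Finsupp.single_apply, Finset.sum_ite_eq', Finsupp.mem_support_iff]
      refine ite_eq_left_iff.mpr fun hzero ↦ ?_
      rw [show (⟨E.repr y i, hyV i⟩ : V) = 0 from Subtype.ext (not_not.mp hzero), map_zero]
    rw [h0, map_zero, Finsupp.zero_apply] at hcoord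
    exact hφ hcoord.symm

/-- Elements of `A ⊗ B` killed by `s ⊗ 1` vanish modulo the annihilator of `s`. -/
theorem map_mk_eq_zero_of_mul_tmul_one_eq_zero {k A B : Type*} [Field k] [CommRing A]
    [CommRing B] [Algebra k A] [Algebra k B] {s : A} {I : Ideal A}
    (hI : ∀ a : A, a ∈ I ↔ a * s = 0) {z : A ⊗[k] B} (h : z * (s ⊗ₜ 1) = 0) :
    Algebra.TensorProduct.map (Ideal.Quotient.mkₐ k I) (AlgHom.id k B) z = 0 := by
  let ψ : (A ⧸ I) →ₗ[A] A :=
    Submodule.liftQ I (LinearMap.toSpanSingleton A A s) fun a ha ↦ (hI a).mp ha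
  have hψ : Function.Injective ψ :=
    LinearMap.ker_eq_bot.mp (Submodule.ker_liftQ_eq_bot _ _ _ fun a ha ↦ (hI a).mpr ha)
  have hmul (z : A ⊗[k] B) : (ψ.restrictScalars k).rTensor B
      (Algebra.TensorProduct.map (Ideal.Quotient.mkₐ k I) (AlgHom.id k B) z) =
        z * (s ⊗ₜ 1) := by
    induction z with
    | zero => simp
    | add z w hz hw => rw [map_add, map_add, hz, hw, add_mul]
    | tmul a b =>
      rw [Algebra.TensorProduct.tmul_mul_tmul, mul_one, Algebra.TensorProduct.map_tmul,
        LinearMap.rTensor_tmul]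
      rfl
  refine Module.Flat.rTensor_preserves_injective_linearMap (M := B) (ψ.restrictScalars k) hψ ?_
  rw [map_zero, ← h]
  exact hmul z

section Convolution

open WithConv

variable {k H C : Type*} [CommRing k] [CommRing H] [HopfAlgebra k H] [CommRing C] [Algebra k C]

theorem AlgHom.conv_self_mul_comp_antipode (f : H →ₐ[k] C) :
    toConv f * toConv (f.comp (HopfAlgebra.antipodeAlgHom k H)) = 1 := by
  have h := AlgHom.comp_convMul_distrib f (toConv (AlgHom.id k H))
    (toConv (HopfAlgebra.antipodeAlgHom k H))
  have h1 : toConv (AlgHom.id k H) * toConv (HopfAlgebra.antipodeAlgHom k H) = 1 :=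
    mul_inv_cancel (toConv (AlgHom.id k H))
  rw [h1] at h
  apply WithConv.ofConv_injective
  refine h.symm.trans ?_
  ext x
  simp [AlgHom.convOne_def, Algebra.ofId_apply]

theorem AlgHom.conv_mul_mul_comp_antipode (f g : H →ₐ[k] C) :
    toConv f * toConv g * toConv (g.comp (HopfAlgebra.antipodeAlgHom k H)) = toConv f := by
  rw [mul_assoc, AlgHom.conv_self_mul_comp_antipode, mul_one]

theorem AlgHom.conv_self_mul_comp_antipode_mul (f g : H →ₐ[k] C) :
    toConv f * (toConv (f.comp (HopfAlgebra.antipodeAlgHom k H)) * toConv g) = toConv g := by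
  rw [← mul_assoc, AlgHom.conv_self_mul_comp_antipode, one_mul]

end Convolution

open WithConv in
/-- In a noetherian commutative Hopf algebra over an algebraically closed field whose nilradical is
prime, every zero divisor is nilpotent. -/
theorem HopfAlgebra.isNilpotent_of_mul_eq_zero {k R : Type*} [Field k] [IsAlgClosed k]
    [CommRing R] [HopfAlgebra k R] [IsNoetherianRing R] (hR : (nilradical R).IsPrime) {r s : R}
    (hs : s ≠ 0) (h : r * s = 0) : IsNilpotent r := by
  by_contra hr
  let N := nilradical R
  let S := HopfAlgebra.antipodeAlgHom k R
  let i : R →ₐ[k] R ⊗[k] (R ⧸ N) := Algebra.TensorProduct.includeLeft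
  let q : R ⧸ N →ₐ[k] R ⊗[k] (R ⧸ N) := Algebra.TensorProduct.includeRight
  let g : R →ₐ[k] R ⊗[k] (R ⧸ N) := q.comp (Ideal.Quotient.mkₐ k N)
  let Φ : R →ₐ[k] R ⊗[k] (R ⧸ N) := (toConv i * toConv (g.comp S)).ofConv
  let τ : R ⊗[k] (R ⧸ N) →ₐ[k] R ⊗[k] (R ⧸ N) :=
    Algebra.TensorProduct.lift (toConv i * toConv g).ofConv q fun _ _ ↦ .all _ _
  have hτi : τ.comp i = (toConv i * toConv g).ofConv :=
    Algebra.TensorProduct.lift_comp_includeLeft _ _ fun _ _ ↦ .all _ _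
  have hτq : τ.comp q = q :=
    Algebra.TensorProduct.lift_comp_includeRight _ _ fun _ _ ↦ .all _ _
  have hτΦ : τ.comp Φ = i := by
    rw [AlgHom.comp_convMul_distrib]
    change (toConv (τ.comp i) * toConv (((τ.comp q).comp _).comp S)).ofConv = i
    rw [hτi, hτq]
    exact congrArg ofConv (AlgHom.conv_mul_mul_comp_antipode i g)
  have hτΦ' (x : R) : τ (Φ x) = i x := DFunLike.congr_fun hτΦ x
  have hi : Function.Injective i :=
    Algebra.TensorProduct.includeLeft_injective (algebraMap k (R ⧸ N)).injective
  have hΦr : ¬ IsNilpotent (Φ r) := fun hn ↦ hr <| by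
    have := hn.map τ
    rwa [hτΦ', IsNilpotent.map_iff hi] at this
  obtain ⟨t, ht, hts⟩ := exists_not_isNilpotent_smul_eq_zero hR hΦr
    (x := Φ s) (by rw [← map_mul, h, map_zero])
  have hprod : (toConv i * toConv g).ofConv t * (s ⊗ₜ 1) = 0 := by
    have : i t * Φ s = 0 := by
      rw [← hts, Algebra.smul_def]; rfl
    have := congrArg τ this
    rwa [map_mul, hτΦ', map_zero, ← AlgHom.comp_apply, hτi] at this
  let I : Ideal R := (Submodule.span R {s}).annihilator
  have hI (x : R) : x ∈ I ↔ x * s = 0 := Submodule.mem_annihilator_span_singleton s x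
  have : Nontrivial (R ⧸ I) := Ideal.Quotient.nontrivial_iff.mpr fun h1 ↦ hs <| by
    simpa using (hI 1).mp ((Ideal.eq_top_iff_one I).mp h1)
  let a : R →ₐ[k] (R ⧸ I) ⊗[k] R :=
    Algebra.TensorProduct.includeLeft.comp (Ideal.Quotient.mkₐ k I)
  let b : R →ₐ[k] (R ⧸ I) ⊗[k] R := Algebra.TensorProduct.includeRight
  have hab : IsNilpotent ((toConv a * toConv b).ofConv t) := by
    refine isNilpotent_of_map_right_eq_zero (Ideal.Quotient.mkₐ_surjective k N)
      (Ideal.Quotient.mkₐ_ker k N).le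
      (Eq.trans ?_ (map_mk_eq_zero_of_mul_tmul_one_eq_zero hI hprod))
    rw [← AlgHom.comp_apply, ← AlgHom.comp_apply, AlgHom.comp_convMul_distrib,
      AlgHom.comp_convMul_distrib]
    have hleft :
        (Algebra.TensorProduct.map (AlgHom.id k (R ⧸ I)) (Ideal.Quotient.mkₐ k N)).comp a =
        (Algebra.TensorProduct.map (Ideal.Quotient.mkₐ k I) (AlgHom.id k (R ⧸ N))).comp i := by
      ext x; simp [a, i]
    have hright :
        (Algebra.TensorProduct.map (AlgHom.id k (R ⧸ I)) (Ideal.Quotient.mkₐ k N)).comp b =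
        (Algebra.TensorProduct.map (Ideal.Quotient.mkₐ k I) (AlgHom.id k (R ⧸ N))).comp g := by
      ext x; simp [b, g, q]
    rw [ofConv_toConv, ofConv_toConv, ofConv_toConv, ofConv_toConv, hleft, hright]
  let σ : (R ⧸ I) ⊗[k] R →ₐ[k] (R ⧸ I) ⊗[k] R :=
    Algebra.TensorProduct.lift Algebra.TensorProduct.includeLeft
      (toConv (a.comp S) * toConv b).ofConv fun _ _ ↦ .all _ _
  have hσa : σ.comp a = a := by
    rw [← AlgHom.comp_assoc, Algebra.TensorProduct.lift_comp_includeLeft]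
  have hσb : σ.comp b = (toConv (a.comp S) * toConv b).ofConv :=
    Algebra.TensorProduct.lift_comp_includeRight _ _ fun _ _ ↦ .all _ _
  have hσ : σ.comp (toConv a * toConv b).ofConv = b := by
    rw [AlgHom.comp_convMul_distrib]
    change (toConv (σ.comp a) * toConv (σ.comp b)).ofConv = b
    rw [hσa, hσb]
    exact congrArg ofConv (AlgHom.conv_self_mul_comp_antipode_mul a b)
  have hb : Function.Injective b :=
    Algebra.TensorProduct.includeRight_injective (algebraMap k (R ⧸ I)).injective
  refine ht ((IsNilpotent.map_iff hb).mp ?_)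
  rw [← hσ]
  exact hab.map σ

theorem stmt19 (𝕂 : Type) [Field 𝕂] [IsAlgClosed 𝕂]
    (R : Type) [CommRing R] [Algebra 𝕂 R] [HopfAlgebra 𝕂 R]
    (hfg : Algebra.FiniteType 𝕂 R)
    (hirr : (nilradical R).IsPrime) :
    ∀ r : R, (∃ s : R, s ≠ 0 ∧ r * s = 0) → IsNilpotent r := by
  rintro r ⟨s, hs, h⟩
  have : IsNoetherianRing R := hfg.isNoetherianRing 𝕂 R
  exact HopfAlgebra.isNilpotent_of_mul_eq_zero (k := 𝕂) hirr hs h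
end
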